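/- arXiv:0710.0390 — 3 statements merged into one kernel-verified Lean document; each statement's English description precedes it below -/
import Mathlib

section
/- Let Λ be a finitely generated free ℤ-module with a symmetric bilinear form B_Λ : Λ × Λ → ℤ that is even (B_Λ(x,x) ∈ 2ℤ for all x) and unimodular (x ↦ B_Λ(x,−) is a bijection Λ → Hom(Λ,ℤ)). Let L = Λ × ℤ with the symmetric bilinear form B((x,a),(y,b)) = B_Λ(x,y) − 2ab. Then there is no vector ρ ∈ L with ρ ∉ 2L such that B(ρ,ρ) = −4 and 2 ∣ B(ρ,w) for every w ∈ L. -/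
/-- A vector pairing evenly with a unimodular lattice is divisible by two. -/
theorem exists_eq_add_self_of_two_dvd {M : Type*} [AddCommGroup M] [Module ℤ M]
    (B : M →ₗ[ℤ] M →ₗ[ℤ] ℤ) (hB : Function.Bijective (fun x : M => B x))
    {x : M} (hx : ∀ y, (2 : ℤ) ∣ B x y) : ∃ u, x = u + u := by
  choose f hf using hx
  let φ : M →ₗ[ℤ] ℤ :=
    { toFun := f
      map_add' := fun y z => by
        have h := map_add (B x) y z
        rw [hf, hf, hf] at h
        lia
      map_smul' := fun c y => by
        have h := (B x).map_smul c y
        rw [hf, hf, smul_eq_mul] at h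
        simp only [RingHom.id_apply, smul_eq_mul]
        linarith }
  obtain ⟨u, hu⟩ := hB.2 φ
  refine ⟨u, hB.1 (LinearMap.ext fun y => ?_)⟩
  have huy : B u y = f y := LinearMap.congr_fun hu y
  simp only [map_add, LinearMap.add_apply, huy, hf y]
  ring


/-- Let `Λ` be a finitely generated free `ℤ`-module with an even
unimodular symmetric bilinear form `BΛ`, and let `L = Λ × ℤ` carry the form
`B ((x,a),(y,b)) = BΛ x y - 2ab`. Then there is no vector `ρ ∈ L`, not in `2L`,
with `B ρ ρ = -4` and `2 ∣ B ρ w` for all `w`. -/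
theorem stmt2 {Λ : Type*} [AddCommGroup Λ] [Module ℤ Λ]
    [Module.Free ℤ Λ] [Module.Finite ℤ Λ]
    (BΛ : Λ →ₗ[ℤ] Λ →ₗ[ℤ] ℤ)
    (hsymm : ∀ x y : Λ, BΛ x y = BΛ y x)
    (heven : ∀ x : Λ, (2 : ℤ) ∣ BΛ x x)
    (hunimod : Function.Bijective (fun x : Λ => BΛ x))
    (B : (Λ × ℤ) → (Λ × ℤ) → ℤ)
    (hB : ∀ p q : Λ × ℤ, B p q = BΛ p.1 q.1 - 2 * p.2 * q.2) :
    ¬ ∃ ρ : Λ × ℤ, (¬ ∃ σ : Λ × ℤ, ρ = 2 • σ) ∧ B ρ ρ = -4 ∧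
      ∀ w : Λ × ℤ, (2 : ℤ) ∣ B ρ w := by
  rintro ⟨⟨x, a⟩, -, hsq, hdiv⟩
  have hx : ∀ y, (2 : ℤ) ∣ BΛ x y := fun y => by
    simpa [hB] using hdiv (y, 0)
  obtain ⟨u, rfl⟩ := exists_eq_add_self_of_two_dvd BΛ hunimod hx
  obtain ⟨k, hk⟩ := heven u
  simp only [hB, map_add, LinearMap.add_apply, hk] at hsq
  have ha : a * a = 4 * k + 2 := by linarith
  rcases Int.even_or_odd' a with ⟨b, rfl | rfl⟩ <;> ring_nf at ha <;> lia
end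

section
/- Let a, b, q be rational numbers satisfying the three equations: 575a² + 50abq + 3b²q² = 3, 690a + 30bq = −3, and q²/4 = 25aq + 3bq². Then 23q² + 20q − 2100 = 0. -/
/-- Elimination of `a` and `b` from the three Lagrangian-plane
equations yields `23q² + 20q − 2100 = 0`. -/
theorem stmt4 (a b q : ℚ)
    (h1 : 575 * a^2 + 50 * a * b * q + 3 * b^2 * q^2 = 3)
    (h2 : 690 * a + 30 * b * q = -3)
    (h3 : q^2 / 4 = 25 * a * q + 3 * b * q^2) :
    23 * q^2 + 20 * q - 2100 = 0 := by
  have hq : q ≠ 0 := by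
    rintro rfl
    have ha : a = -1 / 230 := by linarith
    subst ha
    norm_num at h1
  have h4 : q / 4 = 25 * a + 3 * (b * q) := by
    apply mul_right_cancel₀ hq
    linarith
  have ha : a = -(5 * q + 6) / 880 := by linarith
  have hbq : b * q = (115 * q + 50) / 880 := by linarith
  have h5 : 575 * a^2 + 50 * a * (b * q) + 3 * (b * q)^2 = 3 := by linarith
  rw [hbq, ha] at h5
  linarith
end

section
/- Let a, b be rational numbers and q an integer satisfying the three equations: 575a² + 50abq + 3b²q² = 3, 690a + 30bq = −3, and q²/4 = 25aq + 3bq². Then q = −10, a = 1/20, and b = 1/8. -/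
/-- With `q` an integer, the three Lagrangian-plane equations force
`q = -10`, `a = 1/20`, `b = 1/8`. -/
theorem stmt6 (a b : ℚ) (q : ℤ)
    (h1 : 575 * a^2 + 50 * a * b * (q : ℚ) + 3 * b^2 * (q : ℚ)^2 = 3)
    (h2 : 690 * a + 30 * b * (q : ℚ) = -3)
    (h3 : (q : ℚ)^2 / 4 = 25 * a * (q : ℚ) + 3 * b * (q : ℚ)^2) :
    q = -10 ∧ a = 1/20 ∧ b = 1/8 := by
  have ht : b * (q : ℚ) = -1 / 10 - 23 * a := by linarith
  have hroots : (a - 1 / 20) * (a + 27 / 460) = 0 := by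
    have h : 575 * a ^ 2 + 50 * a * (b * q) + 3 * (b * q) ^ 2 = 3 := by linarith
    rw [ht] at h
    linarith
  have hq0 : (q : ℚ) ≠ 0 := by
    intro h0
    rw [h0, mul_zero] at ht
    have ha : a = -1 / 230 := by linarith
    norm_num [ha] at hroots
  have hq : (q : ℚ) = -6 / 5 - 176 * a := by
    have h : (q : ℚ) / 4 = 25 * a + 3 * (b * q) :=
      mul_right_cancel₀ hq0 (by linarith)
    linarith
  rcases mul_eq_zero.mp hroots with h | h
  · have ha : a = 1 / 20 := by linarith
    have hq' : (q : ℚ) = -10 := by linarith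
    refine ⟨by exact_mod_cast hq', ha, ?_⟩
    rw [hq'] at ht
    linarith
  · have hq' : 23 * (q : ℚ) = 210 := by linarith
    have hz : 23 * q = 210 := by exact_mod_cast hq'
    omega
end
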